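/- arXiv:2501.05696 — 6 statements merged into one kernel-verified Lean document; each statement's English description precedes it below -/
import Mathlib

section
/- Let λ be a real number and let n, α be positive integers with n > α. Then {n brace α}_λ = ∑_{k=1}^{α} (α − k + 1 − λ(n − k)) · {n−k brace α−k+1}_λ. -/
/-- The degenerate falling factorial `(x)_{n,λ} = x(x-λ)⋯(x-(n-1)λ)`. -/
noncomputable def dff (lam x : ℝ) (n : ℕ) : ℝ := ∏ i ∈ Finset.range n, (x - i * lam)

/-- The degenerate Stirling number of the second kind
`{n brace k}_λ = (1/k!) ∑_{j=0}^{k} C(k,j) (-1)^{k-j} (j)_{n,λ}`. -/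
noncomputable def dstirling (lam : ℝ) (n k : ℕ) : ℝ :=
  (1 / (k.factorial : ℝ)) *
    ∑ j ∈ Finset.range (k + 1), (k.choose j : ℝ) * (-1) ^ (k - j) * dff lam (j : ℝ) n

/-- The generalized binomial coefficient `C(x,m) = x(x-1)⋯(x-m+1)/m!` with real upper argument. -/
noncomputable def gchoose (x : ℝ) (m : ℕ) : ℝ := (∏ i ∈ Finset.range m, (x - i)) / m.factorial

/-- Generalized binomial coefficient with integer lower argument; zero when the lower
argument is negative. -/
noncomputable def gchooseZ (x : ℝ) (m : ℤ) : ℝ := if 0 ≤ m then gchoose x m.toNat else 0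

theorem dff_succ (lam x : ℝ) (n : ℕ) : dff lam x (n + 1) = dff lam x n * (x - n * lam) :=
  Finset.prod_range_succ _ _

theorem dstirling_zero_right (lam : ℝ) {n : ℕ} (hn : 0 < n) : dstirling lam n 0 = 0 := by
  have h : dff lam 0 n = 0 := Finset.prod_eq_zero (Finset.mem_range.2 hn) (by simp)
  simp [dstirling, h]

/-- The triangular recurrence for degenerate Stirling numbers of the second kind. -/
theorem dstirling_succ_succ (lam : ℝ) (n k : ℕ) :
    dstirling lam (n + 1) (k + 1) =
      dstirling lam n k + ((k : ℝ) + 1 - lam * n) * dstirling lam n (k + 1) := by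
  have key : ∑ j ∈ Finset.range (k + 2),
      ((k + 1).choose j : ℝ) * (-1) ^ (k + 1 - j) * dff lam (j : ℝ) n * ((k : ℝ) + 1 - j) =
      -(((k : ℝ) + 1) *
        ∑ j ∈ Finset.range (k + 1), (k.choose j : ℝ) * (-1) ^ (k - j) * dff lam (j : ℝ) n) := by
    rw [Finset.sum_range_succ, Finset.mul_sum, ← Finset.sum_neg_distrib]
    push_cast
    rw [sub_self, mul_zero, add_zero]
    refine Finset.sum_congr rfl fun j hj => ?_
    have hj' : j ≤ k := Nat.lt_succ_iff.1 (Finset.mem_range.1 hj)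
    have hc : (k.choose j : ℝ) * ((k : ℝ) + 1) = (k + 1).choose j * ((k : ℝ) + 1 - j) := by
      have := congrArg (Nat.cast (R := ℝ)) (Nat.choose_mul_succ_eq k j)
      push_cast [Nat.cast_sub (Nat.le_succ_of_le hj')] at this
      exact this
    rw [Nat.succ_sub hj', pow_succ]
    linear_combination (-1) ^ (k - j) * dff lam (j : ℝ) n * hc
  have split : ∑ j ∈ Finset.range (k + 2),
      ((k + 1).choose j : ℝ) * (-1) ^ (k + 1 - j) * dff lam (j : ℝ) (n + 1) =
      ((k : ℝ) + 1 - lam * n) * (∑ j ∈ Finset.range (k + 2),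
        ((k + 1).choose j : ℝ) * (-1) ^ (k + 1 - j) * dff lam (j : ℝ) n) -
      ∑ j ∈ Finset.range (k + 2),
        ((k + 1).choose j : ℝ) * (-1) ^ (k + 1 - j) * dff lam (j : ℝ) n * ((k : ℝ) + 1 - j) := by
    rw [Finset.mul_sum, ← Finset.sum_sub_distrib]
    refine Finset.sum_congr rfl fun j _ => ?_
    rw [dff_succ]
    ring
  have hk : (k.factorial : ℝ) ≠ 0 := Nat.cast_ne_zero.2 k.factorial_ne_zero
  have hk1 : (k : ℝ) + 1 ≠ 0 := k.cast_add_one_ne_zero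
  simp only [dstirling]
  rw [split, key, Nat.factorial_succ]
  push_cast
  field_simp
  ring

theorem dstirling_eq_sum_range (lam : ℝ) (n α : ℕ) (h : α < n) :
    dstirling lam n α =
      ∑ i ∈ Finset.range α,
        ((α : ℝ) - i - lam * ((n : ℝ) - (i + 1))) * dstirling lam (n - (i + 1)) (α - i) := by
  induction α generalizing n with
  | zero => simpa using dstirling_zero_right lam h
  | succ a ih =>
    obtain ⟨m, rfl⟩ : ∃ m, n = m + 1 := ⟨n - 1, by omega⟩
    rw [dstirling_succ_succ, ih m (by omega), Finset.sum_range_succ']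
    congr 1
    · refine Finset.sum_congr rfl fun i _ => ?_
      rw [Nat.add_sub_add_right, Nat.add_sub_add_right]
      push_cast
      ring
    · simp

theorem dstirling_recurrence (lam : ℝ) (n α : ℕ) (hα : 0 < α) (h : α < n) :
    dstirling lam n α =
      ∑ k ∈ Finset.Icc 1 α,
        ((α : ℝ) - k + 1 - lam * ((n : ℝ) - k)) * dstirling lam (n - k) (α - k + 1) := by
  rw [dstirling_eq_sum_range lam n α h, Finset.range_eq_Ico,
    ← Finset.Ico_add_one_right_eq_Icc, ← Finset.sum_Ico_add' _ 0 α 1]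
  refine Finset.sum_congr rfl fun i hi => ?_
  have hi' : i < α := (Finset.mem_Ico.1 hi).2
  rw [show α - (i + 1) + 1 = α - i by omega]
  push_cast
  ring
end

section
/- Let λ be a real number and let α, n be nonnegative integers with n ≥ α. Then ∑_{j=α}^{n} {n brace j}_λ · j! · C((n−1)λ, j−α) = α! · {n brace α}_{−λ}, where C((n−1)λ, j−α) is the generalized binomial coefficient with real upper argument (n−1)λ. -/
open Polynomial in
theorem gchoose_eq_eval_descPochhammer (y : ℝ) (k : ℕ) :
    gchoose y k = (C ((k.factorial : ℝ)⁻¹) * descPochhammer ℝ k).eval y := by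
  rw [gchoose, eval_mul, eval_C, descPochhammer_eval_eq_prod_range, div_eq_inv_mul]

theorem gchoose_natCast (m k : ℕ) : gchoose m k = m.choose k := by
  have hk : (k.factorial : ℝ) ≠ 0 := Nat.cast_ne_zero.2 k.factorial_ne_zero
  rw [gchoose, ← descPochhammer_eval_eq_prod_range, descPochhammer_eval_eq_descFactorial,
    Nat.descFactorial_eq_factorial_mul_choose, Nat.cast_mul, mul_div_cancel_left₀ _ hk]

/-- The Gregory-Newton formula for a real shift of a polynomial function. -/
theorem eval_add_eq_sum_gchoose_mul_fwdDiff_iter (P : Polynomial ℝ) {d : ℕ}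
    (hP : P.natDegree ≤ d) (x y : ℝ) :
    P.eval (x + y) =
      ∑ k ∈ Finset.range (d + 1), gchoose y k * (fwdDiff 1)^[k] (fun t ↦ P.eval t) x := by
  let A : Polynomial ℝ := P.comp (Polynomial.C x + Polynomial.X)
  let B : Polynomial ℝ := ∑ k ∈ Finset.range (d + 1),
    Polynomial.C ((k.factorial : ℝ)⁻¹) * descPochhammer ℝ k *
      Polynomial.C ((fwdDiff 1)^[k] (fun t ↦ P.eval t) x)
  have hA (z : ℝ) : A.eval z = P.eval (x + z) := by simp [A]
  have hB (z : ℝ) : B.eval z =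
      ∑ k ∈ Finset.range (d + 1), gchoose z k * (fwdDiff 1)^[k] (fun t ↦ P.eval t) x := by
    simp only [B, Polynomial.eval_finsetSum, gchoose_eq_eval_descPochhammer,
      Polynomial.eval_mul, Polynomial.eval_C]
  suffices A = B by rw [← hA, ← hB, this]
  refine Polynomial.eq_of_infinite_eval_eq A B
    ((Set.infinite_range_of_injective Nat.cast_injective).mono ?_)
  rintro _ ⟨m, rfl⟩
  have newton := shift_eq_sum_fwdDiff_iter (1 : ℝ) (fun t ↦ P.eval t) m x
  simp only [nsmul_eq_mul, mul_one] at newton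
  rw [Set.mem_ofPred_eq, hA, hB, newton]
  simp only [gchoose_natCast]
  obtain hmd | hdm := le_total m d
  · refine Finset.sum_subset (Finset.range_mono (by omega)) fun k _ hk ↦ ?_
    rw [Nat.choose_eq_zero_of_lt (by simpa using hk), Nat.cast_zero, zero_mul]
  · refine (Finset.sum_subset (Finset.range_mono (by omega)) fun k _ hk ↦ ?_).symm
    have hdk : P.natDegree < k := hP.trans_lt (by simpa using hk)
    have vanish := congrFun (Polynomial.fwdDiff_iter_eq_zero_of_degree_lt hdk) x
    rw [Pi.zero_apply] at vanish
    rw [vanish, mul_zero]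

theorem fwdDiff_iter_eval_eq_sum_gchoose (P : Polynomial ℝ) {n : ℕ} (hP : P.natDegree ≤ n)
    (α : ℕ) (y : ℝ) :
    (fwdDiff 1)^[α] (fun t ↦ P.eval t) y =
      ∑ m ∈ Finset.range (n + 1), gchoose y m * (fwdDiff 1)^[α + m] (fun t ↦ P.eval t) 0 := by
  simp only [Function.iterate_add_apply]
  rw [fwdDiff_iter_eq_sum_shift]
  have expand (m : ℕ) := fwdDiff_iter_eq_sum_shift 1 ((fwdDiff 1)^[m] fun t ↦ P.eval t) α 0
  simp only [expand, add_comm y, eval_add_eq_sum_gchoose_mul_fwdDiff_iter P hP _ y,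
    Finset.smul_sum, Finset.mul_sum, zero_add]
  rw [Finset.sum_comm]
  simp only [mul_smul_comm]

theorem factorial_mul_dstirling (lam : ℝ) (n k : ℕ) :
    (k.factorial : ℝ) * dstirling lam n k = (fwdDiff 1)^[k] (fun t ↦ dff lam t n) 0 := by
  have hk : (k.factorial : ℝ) ≠ 0 := Nat.cast_ne_zero.2 k.factorial_ne_zero
  rw [dstirling, ← mul_assoc, mul_one_div_cancel hk, one_mul, fwdDiff_iter_eq_sum_shift]
  refine Finset.sum_congr rfl fun j _ ↦ ?_
  simp only [nsmul_eq_mul, mul_one, zero_add, zsmul_eq_mul]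
  push_cast
  ring

theorem dff_neg (lam x : ℝ) (n : ℕ) : dff (-lam) x n = dff lam (x + (n - 1) * lam) n := by
  rw [dff, dff, ← Finset.prod_range_reflect]
  refine Finset.prod_congr rfl fun i hi ↦ ?_
  have hin : i + 1 ≤ n := Finset.mem_range.1 hi
  rw [Nat.sub_sub, Nat.cast_sub (by omega)]
  push_cast
  ring

open Polynomial in
theorem exists_polynomial_eval_eq_dff (lam : ℝ) (n : ℕ) :
    ∃ P : ℝ[X], P.natDegree = n ∧ (fun t ↦ P.eval t) = fun t ↦ dff lam t n := by
  refine ⟨∏ i ∈ Finset.range n, (X - C (i * lam)), ?_, ?_⟩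
  · rw [natDegree_prod_of_monic _ _ fun i _ ↦ monic_X_sub_C _]
    simp only [natDegree_X_sub_C, Finset.sum_const, Finset.card_range, smul_eq_mul, mul_one]
  · funext t
    simp only [dff, eval_prod, eval_sub, eval_X, eval_C]

theorem dstirling_sum_gchoose_eq (lam : ℝ) (α n : ℕ) (h : α ≤ n) :
    ∑ j ∈ Finset.Icc α n,
        dstirling lam n j * (j.factorial : ℝ) * gchoose (((n : ℝ) - 1) * lam) (j - α) =
      (α.factorial : ℝ) * dstirling (-lam) n α := by
  obtain ⟨P, hPn, hP⟩ := exists_polynomial_eval_eq_dff lam n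
  rw [factorial_mul_dstirling]
  simp only [dff_neg, mul_comm (dstirling lam n _), factorial_mul_dstirling]
  rw [fwdDiff_iter_comp_add 1 (fun t ↦ dff lam t n), zero_add, ← hP,
    fwdDiff_iter_eval_eq_sum_gchoose P hPn.le, ← Finset.Ico_add_one_right_eq_Icc,
    Finset.sum_Ico_eq_sum_range]
  simp only [Nat.add_sub_cancel_left, mul_comm (gchoose _ _)]
  refine Finset.sum_subset (Finset.range_mono (by omega)) fun m _ hm ↦ ?_
  have hdeg : P.natDegree < α + m := by
    rw [Finset.mem_range] at hm
    omega
  have vanish := congrFun (Polynomial.fwdDiff_iter_eq_zero_of_degree_lt hdeg) 0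
  rw [Pi.zero_apply] at vanish
  rw [vanish, zero_mul]
end

section
/- Let λ, x, h be real numbers with h ≠ 0, and let n, p be nonnegative integers. Then (1/n!) · h^{−n} · ∑_{k=0}^{n} C(n,k)(−1)^{n−k}(x+kh)_{p,λ} = ∑_{r=0}^{p} C(p,r) · (x)_{p−r,λ} · h^{r−n} · {r brace n}_{λ/h}. (The left-hand side is (1/n!) times the n-th iterate of the difference operator Δ_{x,h}f(x) = (f(x+h)−f(x))/h applied to (x)_{p,λ}.) -/
theorem dff_mul_right (lam x : ℝ) {h : ℝ} (hh : h ≠ 0) (n : ℕ) :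
    dff lam (x * h) n = h ^ n * dff (lam / h) x n := by
  rw [dff, dff, ← Finset.card_range n, ← Finset.prod_const, Finset.card_range,
    ← Finset.prod_mul_distrib]
  refine Finset.prod_congr rfl fun i _ => ?_
  field_simp

/-- The Vandermonde convolution for degenerate falling factorials. -/
theorem dff_add (lam x y : ℝ) (n : ℕ) :
    dff lam (x + y) n = ∑ ij ∈ Finset.HasAntidiagonal.antidiagonal n,
      (n.choose ij.1 : ℝ) * (dff lam y ij.1 * dff lam x ij.2) := by
  induction n with
  | zero => simp [dff]
  | succ n ih =>
    rw [Finset.sum_antidiagonal_choose_succ_mul (fun i j => dff lam y i * dff lam x j),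
      dff_succ, ih, Finset.sum_mul, ← Finset.sum_add_distrib]
    refine Finset.sum_congr rfl fun ij hij => ?_
    have hn : ij.1 + ij.2 = n := Finset.HasAntidiagonal.mem_antidiagonal.mp hij
    rw [Nat.choose_symm_of_eq_add hn.symm, dff_succ, dff_succ, ← hn]
    push_cast
    ring

theorem finite_difference_dff (lam x h : ℝ) (hh : h ≠ 0) (n p : ℕ) :
    (1 / (n.factorial : ℝ)) * h ^ (-(n : ℤ)) *
        ∑ k ∈ Finset.range (n + 1),
          (n.choose k : ℝ) * (-1) ^ (n - k) * dff lam (x + k * h) p =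
      ∑ r ∈ Finset.range (p + 1),
        (p.choose r : ℝ) * dff lam x (p - r) * h ^ ((r : ℤ) - (n : ℤ)) *
          dstirling (lam / h) r n := by
  have key (k : ℕ) : dff lam (x + k * h) p = ∑ r ∈ Finset.range (p + 1),
      (p.choose r : ℝ) * dff lam x (p - r) * h ^ r * dff (lam / h) k r := by
    rw [dff_add, Finset.Nat.sum_antidiagonal_eq_sum_range_succ
      (fun i j => (p.choose i : ℝ) * (dff lam (k * h) i * dff lam x j))]
    refine Finset.sum_congr rfl fun r _ => ?_
    rw [dff_mul_right lam k hh]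
    ring
  simp only [key, dstirling, Finset.mul_sum]
  rw [Finset.sum_comm]
  refine Finset.sum_congr rfl fun r _ => Finset.sum_congr rfl fun k _ => ?_
  rw [sub_eq_add_neg, zpow_add₀ hh, zpow_natCast]
  ring
end

section
/- Let λ and x be real numbers and let n, r be nonnegative integers. Then S_n(x, r|λ) = (−1)^n · ∑_{j=0}^{r} C(x, j) · C(x−j−1, n−j) · j! · {r brace j}_λ, where C(x,j) and C(x−j−1, n−j) are generalized binomial coefficients with real upper arguments, and S_n(x, r|λ) = ∑_{k=0}^{n} (−1)^k C(x,k)(k)_{r,λ}. -/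
/-- `S_n(x, r|λ) = ∑_{k=0}^{n} (-1)^k C(x,k) (k)_{r,λ}`. -/
noncomputable def Spoly (lam x : ℝ) (n r : ℕ) : ℝ :=
  ∑ k ∈ Finset.range (n + 1), (-1 : ℝ) ^ k * gchoose x k * dff lam (k : ℝ) r

open Finset in
theorem fwdDiff_iter_dff_eq_factorial_mul_dstirling (lam : ℝ) (r j : ℕ) :
    (fwdDiff (1 : ℝ))^[j] (fun y => dff lam y r) 0 = j.factorial * dstirling lam r j := by
  have hj : (j.factorial : ℝ) ≠ 0 := by exact_mod_cast j.factorial_ne_zero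
  rw [fwdDiff_iter_eq_sum_shift, dstirling, ← mul_assoc, mul_one_div_cancel hj, one_mul]
  refine sum_congr rfl fun i _ => ?_
  simp [zsmul_eq_mul, mul_comm]

open Polynomial Finset in
theorem fwdDiff_iter_dff_eq_zero (lam : ℝ) {r j : ℕ} (h : r < j) :
    (fwdDiff (1 : ℝ))^[j] (fun y => dff lam y r) = 0 := by
  let P : ℝ[X] := ∏ i ∈ range r, (X - C (i * lam))
  have hP : (fun y => dff lam y r) = P.eval := by
    ext y
    simp [P, dff, eval_prod]
  have hdeg : P.natDegree = r := by
    simp only [P]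
    rw [natDegree_prod_of_monic _ _ fun i _ => monic_X_sub_C _]
    simp only [natDegree_X_sub_C, sum_const, card_range, smul_eq_mul, mul_one]
  rw [hP]
  exact fwdDiff_iter_eq_zero_of_degree_lt (hdeg ▸ h)

open Finset in
theorem dff_natCast_eq_sum (lam : ℝ) (k r : ℕ) :
    dff lam (k : ℝ) r =
      ∑ j ∈ range (r + 1), (k.choose j : ℝ) * (j.factorial * dstirling lam r j) := by
  have h := shift_eq_sum_fwdDiff_iter (1 : ℝ) (fun y => dff lam y r) k 0
  simp only [zero_add, nsmul_eq_mul, mul_one,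
    fwdDiff_iter_dff_eq_factorial_mul_dstirling] at h
  rw [h]
  have hz (j : ℕ) (hj : r < j) : (j.factorial : ℝ) * dstirling lam r j = 0 := by
    rw [← fwdDiff_iter_dff_eq_factorial_mul_dstirling, fwdDiff_iter_dff_eq_zero lam hj]
    rfl
  calc
    _ = ∑ j ∈ range (max k r + 1), (k.choose j : ℝ) * (j.factorial * dstirling lam r j) := by
      refine sum_subset (range_mono (by omega)) fun j _ hj => ?_
      rw [mem_range, not_lt] at hj
      rw [Nat.choose_eq_zero_of_lt (by omega)]
      simp
    _ = _ := by
      symm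
      refine sum_subset (range_mono (by omega)) fun j _ hj => ?_
      rw [mem_range, not_lt] at hj
      rw [hz j (by omega), mul_zero]

theorem gchoose_zero (x : ℝ) : gchoose x 0 = 1 := by simp [gchoose]

theorem gchoose_pascal (x : ℝ) (m : ℕ) :
    gchoose x (m + 1) = gchoose (x - 1) m + gchoose (x - 1) (m + 1) := by
  have hm : (m.factorial : ℝ) ≠ 0 := by exact_mod_cast m.factorial_ne_zero
  have hm' : (m : ℝ) + 1 ≠ 0 := by positivity
  have hprod : ∏ i ∈ Finset.range m, (x - ((i + 1 : ℕ) : ℝ)) =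
      ∏ i ∈ Finset.range m, (x - 1 - i) :=
    Finset.prod_congr rfl fun i _ => by push_cast; ring
  simp only [gchoose, Nat.factorial_succ]
  rw [Finset.prod_range_succ', Finset.prod_range_succ, hprod]
  push_cast
  field_simp
  ring

theorem gchoose_mul_choose (x : ℝ) (j m : ℕ) :
    gchoose x (j + m) * ((j + m).choose j : ℝ) = gchoose x j * gchoose (x - j) m := by
  have hj : (j.factorial : ℝ) ≠ 0 := by exact_mod_cast j.factorial_ne_zero
  have hm : (m.factorial : ℝ) ≠ 0 := by exact_mod_cast m.factorial_ne_zero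
  have hprod : ∏ i ∈ Finset.range m, (x - ((j + i : ℕ) : ℝ)) =
      ∏ i ∈ Finset.range m, (x - j - i) :=
    Finset.prod_congr rfl fun i _ => by push_cast; ring
  rw [Nat.cast_add_choose]
  simp only [gchoose]
  rw [Finset.prod_range_add, hprod]
  field_simp

theorem sum_gchoose_mul_choose (x : ℝ) (j m : ℕ) :
    ∑ k ∈ Finset.range (j + m + 1), (-1 : ℝ) ^ k * gchoose x k * (k.choose j : ℝ) =
      (-1) ^ (j + m) * (gchoose x j * gchoose (x - j - 1) m) := by
  induction m with
  | zero =>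
    rw [add_zero, Finset.sum_range_succ, Finset.sum_eq_zero]
    · simp [gchoose_zero]
    · intro k hk
      rw [Nat.choose_eq_zero_of_lt (Finset.mem_range.1 hk)]
      simp
  | succ m ih =>
    rw [← add_assoc, Finset.sum_range_succ, ih, mul_assoc, add_assoc j m 1,
      gchoose_mul_choose, gchoose_pascal (x - j) m]
    ring

theorem sum_gchoose_mul_choose_eq_gchooseZ (x : ℝ) (n j : ℕ) :
    ∑ k ∈ Finset.range (n + 1), (-1 : ℝ) ^ k * gchoose x k * (k.choose j : ℝ) =
      (-1) ^ n * (gchoose x j * gchooseZ (x - j - 1) ((n : ℤ) - (j : ℤ))) := by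
  rcases le_or_gt j n with h | h
  · obtain ⟨m, rfl⟩ := Nat.exists_eq_add_of_le h
    simp [gchooseZ, sum_gchoose_mul_choose]
  · rw [gchooseZ, if_neg (by omega), mul_zero, mul_zero]
    refine Finset.sum_eq_zero fun k hk => ?_
    rw [Finset.mem_range] at hk
    rw [Nat.choose_eq_zero_of_lt (by omega)]
    simp

theorem Spoly_explicit (lam x : ℝ) (n r : ℕ) :
    Spoly lam x n r =
      (-1 : ℝ) ^ n * ∑ j ∈ Finset.range (r + 1),
        gchoose x j * gchooseZ (x - j - 1) ((n : ℤ) - (j : ℤ)) * (j.factorial : ℝ) *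
          dstirling lam r j := by
  simp only [Spoly, dff_natCast_eq_sum, Finset.mul_sum]
  rw [Finset.sum_comm]
  refine Finset.sum_congr rfl fun j _ => ?_
  simp only [← mul_assoc]
  rw [← Finset.sum_mul, ← Finset.sum_mul, sum_gchoose_mul_choose_eq_gchooseZ]
  ring
end

section
/- Let λ and x be real numbers and let r be a nonnegative integer. Then the series ∑_{k=0}^{∞} ((k)_{r,λ}/k!)·cos(kx) converges and ∑_{k=0}^{∞} ((k)_{r,λ}/k!)·cos(kx) = e^{cos x} · ( cos(sin x) · ∑_{j=0}^{r} {r brace j}_λ · cos(jx) − sin(sin x) · ∑_{j=0}^{r} {r brace j}_λ · sin(jx) ). -/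
lemma dstirling_eq_fwdDiff_iter (lam : ℝ) (n k : ℕ) :
    dstirling lam n k = (fwdDiff (1 : ℝ))^[k] (fun x : ℝ => dff lam x n) 0 / k.factorial := by
  rw [fwdDiff_iter_eq_sum_shift, dstirling, one_div_mul_eq_div]
  congr 1
  refine Finset.sum_congr rfl fun j _ => ?_
  simp only [zero_add, nsmul_eq_mul, mul_one, zsmul_eq_mul]
  push_cast
  ring

lemma dstirling_eq_zero_of_lt (lam : ℝ) {n k : ℕ} (h : n < k) : dstirling lam n k = 0 := by
  set P : Polynomial ℝ :=
    ∏ i ∈ Finset.range n, (Polynomial.X - Polynomial.C ((i : ℝ) * lam)) with hP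
  have hfun : (fun x : ℝ => dff lam x n) = P.eval := by
    funext x
    simp [hP, dff, Polynomial.eval_prod]
  have hdeg : P.natDegree < k := by
    rw [hP, Polynomial.natDegree_finsetProd_X_sub_C_eq_card, Finset.card_range]
    exact h
  rw [dstirling_eq_fwdDiff_iter, hfun, Polynomial.fwdDiff_iter_eq_zero_of_degree_lt hdeg]
  simp

/-- Degenerate falling factorials expand in ordinary falling factorials, with the degenerate
Stirling numbers of the second kind as coefficients. -/
lemma dff_natCast_eq_sum_dstirling (lam : ℝ) (n k : ℕ) :
    dff lam k n = ∑ j ∈ Finset.range (n + 1), dstirling lam n j * k.descFactorial j := by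
  have h := shift_eq_sum_fwdDiff_iter (1 : ℝ) (fun x : ℝ => dff lam x n) k 0
  have hterm (j : ℕ) : k.choose j • (fwdDiff (1 : ℝ))^[j] (fun x : ℝ => dff lam x n) 0 =
      dstirling lam n j * k.descFactorial j := by
    rw [dstirling_eq_fwdDiff_iter, Nat.descFactorial_eq_factorial_mul_choose, nsmul_eq_mul]
    push_cast
    field_simp
  simp only [zero_add, nsmul_eq_mul, mul_one] at h
  rw [h]
  simp only [← nsmul_eq_mul, hterm]
  trans ∑ j ∈ Finset.range (max n k + 1), dstirling lam n j * k.descFactorial j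
  · refine Finset.sum_subset (Finset.range_mono (by omega)) fun j _ hj => ?_
    rw [Nat.descFactorial_of_lt (by simpa using hj)]
    simp
  · refine (Finset.sum_subset (Finset.range_mono (by omega)) fun j _ hj => ?_).symm
    rw [dstirling_eq_zero_of_lt lam (by simpa using hj), zero_mul]

lemma hasSum_descFactorial_mul_pow_div_factorial (z : ℂ) (j : ℕ) :
    HasSum (fun k : ℕ => (k.descFactorial j : ℂ) / k.factorial * z ^ k)
      (z ^ j * Complex.exp z) := by
  have hzero : ∑ k ∈ Finset.range j, (k.descFactorial j : ℂ) / k.factorial * z ^ k = 0 :=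
    Finset.sum_eq_zero fun k hk => by
      rw [Nat.descFactorial_of_lt (Finset.mem_range.mp hk)]
      simp
  rw [← add_zero (z ^ j * Complex.exp z), ← hzero, ← hasSum_nat_add_iff j,
    Complex.exp_eq_exp_ℂ]
  convert! (NormedSpace.expSeries_div_hasSum_exp z).mul_left (z ^ j) using 2 with m
  have hfac : (m.factorial : ℂ) * (m + j).descFactorial j = (m + j).factorial := by
    have := Nat.factorial_mul_descFactorial (Nat.le_add_left j m)
    rw [Nat.add_sub_cancel] at this
    exact_mod_cast this
  have hm : (m.factorial : ℂ) ≠ 0 := Nat.cast_ne_zero.mpr m.factorial_ne_zero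
  have hmj : ((m + j).factorial : ℂ) ≠ 0 := Nat.cast_ne_zero.mpr (m + j).factorial_ne_zero
  field_simp
  rw [← hfac]
  ring

/-- The exponential generating function of `k ↦ (k)_{r,λ}`. -/
lemma hasSum_dff_div_factorial_mul_pow (lam : ℝ) (r : ℕ) (z : ℂ) :
    HasSum (fun k : ℕ => ((dff lam k r / k.factorial : ℝ) : ℂ) * z ^ k)
      (Complex.exp z * ∑ j ∈ Finset.range (r + 1), (dstirling lam r j : ℂ) * z ^ j) := by
  convert! hasSum_sum (s := Finset.range (r + 1)) fun j _ =>
    (hasSum_descFactorial_mul_pow_div_factorial z j).mul_left (dstirling lam r j : ℂ) using 1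
  · funext k
    rw [dff_natCast_eq_sum_dstirling]
    push_cast
    rw [Finset.sum_div, Finset.sum_mul]
    exact Finset.sum_congr rfl fun j _ => by ring
  · rw [Finset.mul_sum]
    exact Finset.sum_congr rfl fun j _ => by ring

theorem hasSum_cos_dff (lam x : ℝ) (r : ℕ) :
    HasSum (fun k : ℕ => dff lam (k : ℝ) r / (k.factorial : ℝ) * Real.cos (k * x))
      (Real.exp (Real.cos x) *
        (Real.cos (Real.sin x) *
            ∑ j ∈ Finset.range (r + 1), dstirling lam r j * Real.cos (j * x) -
          Real.sin (Real.sin x) *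
            ∑ j ∈ Finset.range (r + 1), dstirling lam r j * Real.sin (j * x))) := by
  have hpow (k : ℕ) : Complex.exp (x * Complex.I) ^ k =
      Real.cos (k * x) + Real.sin (k * x) * Complex.I := by
    rw [← Complex.exp_nat_mul, ← mul_assoc, Complex.exp_mul_I]
    push_cast
    rfl
  have hexp : Complex.exp (Complex.exp (x * Complex.I)) = Real.exp (Real.cos x) *
      (Real.cos (Real.sin x) + Real.sin (Real.sin x) * Complex.I) := by
    rw [Complex.exp_mul_I x, Complex.exp_add, Complex.exp_mul_I]
    push_cast
    rfl
  have h := Complex.hasSum_re (hasSum_dff_div_factorial_mul_pow lam r (Complex.exp (x * Complex.I)))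
  have hsum : ∑ j ∈ Finset.range (r + 1), (dstirling lam r j : ℂ) * Complex.exp (x * Complex.I) ^ j =
      (∑ j ∈ Finset.range (r + 1), dstirling lam r j * Real.cos (j * x) : ℝ) +
      (∑ j ∈ Finset.range (r + 1), dstirling lam r j * Real.sin (j * x) : ℝ) * Complex.I := by
    simp only [hpow, Complex.ofReal_sum, Finset.sum_mul, ← Finset.sum_add_distrib]
    exact Finset.sum_congr rfl fun j _ => by push_cast; ring
  rw [hsum, hexp] at h
  convert! h using 1
  · funext k
    rw [hpow, Complex.re_ofReal_mul]
    simp [-Complex.ofReal_cos, -Complex.ofReal_sin]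
  · rw [mul_assoc, Complex.re_ofReal_mul]
    simp [-Complex.ofReal_cos, -Complex.ofReal_sin, -Complex.ofReal_sum]
end

section
/- Let λ be a real number, let n be a nonnegative integer and let r be a positive integer. Then ∑_{k=0}^{n} (k)_{r,λ} = ∑_{j=0}^{r} (−1)^{r−j} · j! · {r brace j}_{−λ} · C(n+j, j+1), where C(n+j, j+1) is the usual binomial coefficient. -/
theorem factorial_mul_dstirling_s17 (lam : ℝ) (n k : ℕ) :
    (k.factorial : ℝ) * dstirling lam n k =
      ∑ j ∈ Finset.range (k + 1), (k.choose j : ℝ) * (-1) ^ (k - j) * dff lam (j : ℝ) n := by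
  have hk : (k.factorial : ℝ) ≠ 0 := by exact_mod_cast k.factorial_ne_zero
  rw [dstirling, ← mul_assoc, mul_one_div_cancel hk, one_mul]

theorem dstirling_zero_zero (lam : ℝ) : dstirling lam 0 0 = 1 := by
  simp [dstirling, dff]

theorem dstirling_zero_succ (lam : ℝ) (k : ℕ) : dstirling lam 0 (k + 1) = 0 := by
  have h := add_pow (1 : ℝ) (-1) (k + 1)
  have h' : ∑ j ∈ Finset.range (k + 1 + 1),
      ((k + 1).choose j : ℝ) * (-1) ^ (k + 1 - j) * dff lam (j : ℝ) 0 = 0 := by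
    rw [add_neg_cancel, zero_pow k.succ_ne_zero] at h
    rw [h]
    exact Finset.sum_congr rfl fun j _ => by simp [dff, mul_comm]
  rw [dstirling, h', mul_zero]

theorem dstirling_succ_zero (lam : ℝ) (n : ℕ) : dstirling lam (n + 1) 0 = 0 := by
  simp [dstirling, dff, Finset.prod_range_succ']

theorem dstirling_succ_zero_eq_mul (lam : ℝ) (n : ℕ) :
    dstirling lam (n + 1) 0 = -(n * lam) * dstirling lam n 0 := by
  simp [dstirling, dff_succ, mul_comm]

/-- The triangular recurrence for `k! {n brace k}_λ`. -/
theorem factorial_mul_dstirling_succ_succ (lam : ℝ) (n k : ℕ) :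
    ((k + 1).factorial : ℝ) * dstirling lam (n + 1) (k + 1) =
      (k + 1 - n * lam) * ((k + 1).factorial * dstirling lam n (k + 1)) +
        (k + 1) * (k.factorial * dstirling lam n k) := by
  simp only [factorial_mul_dstirling_s17, dff_succ]
  rw [Finset.sum_range_succ, Finset.sum_range_succ _ (k + 1), mul_add, Finset.mul_sum,
    Finset.mul_sum, add_right_comm, ← Finset.sum_add_distrib]
  congr 1
  · refine Finset.sum_congr rfl fun j hj => ?_
    have hjk : j ≤ k := Nat.lt_succ_iff.mp (Finset.mem_range.mp hj)
    have h : (k.choose j : ℝ) * (k + 1) = (k + 1).choose j * (k + 1 - j) := by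
      have := congrArg (Nat.cast (R := ℝ)) (Nat.choose_mul_succ_eq k j)
      push_cast [Nat.cast_sub (show j ≤ k + 1 by omega)] at this
      exact this
    rw [Nat.succ_sub hjk, pow_succ]
    linear_combination (-(-1) ^ (k - j) * dff lam j n) * h
  · push_cast
    ring

theorem factorial_mul_dstirling_eq_zero_of_lt (lam : ℝ) {n k : ℕ} (h : n < k) :
    (k.factorial : ℝ) * dstirling lam n k = 0 := by
  induction n generalizing k with
  | zero =>
    obtain ⟨k, rfl⟩ := Nat.exists_eq_succ_of_ne_zero h.ne'
    rw [Nat.succ_eq_add_one, dstirling_zero_succ, mul_zero]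
  | succ n ih =>
    obtain ⟨k, rfl⟩ := Nat.exists_eq_succ_of_ne_zero (Nat.ne_zero_of_lt h)
    rw [Nat.succ_eq_add_one, factorial_mul_dstirling_succ_succ, ih (by omega), ih (by omega)]
    ring

theorem succ_mul_multichoose_succ (n k : ℕ) :
    (k + 1) * n.multichoose (k + 1) = (n + k) * n.multichoose k := by
  cases n with
  | zero => cases k <;> simp
  | succ n =>
    have h := Nat.add_one_mul_choose_eq (n + k) k
    rw [Nat.multichoose_eq, Nat.multichoose_eq, show n + 1 + (k + 1) - 1 = n + k + 1 by omega,
      show n + 1 + k - 1 = n + k by omega]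
    linarith

theorem sum_range_multichoose_succ (n k : ℕ) :
    ∑ m ∈ Finset.range (n + 1), m.multichoose (k + 1) = (n + (k + 1)).choose (k + 1 + 1) := by
  induction n with
  | zero => simp
  | succ n ih =>
    rw [Finset.sum_range_succ, ih, Nat.multichoose_eq,
      show n + 1 + (k + 1) - 1 = n + (k + 1) by omega,
      show n + 1 + (k + 1) = n + (k + 1) + 1 by omega, Nat.choose_succ_succ' _ (k + 1), add_comm]

/-- Expansion of the degenerate falling factorial in rising binomial coefficients. -/
theorem dff_eq_sum_multichoose (lam : ℝ) (k r : ℕ) :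
    dff lam (k : ℝ) r = ∑ j ∈ Finset.range (r + 1),
      (-1 : ℝ) ^ (r + j) * (j.factorial * dstirling (-lam) r j) * k.multichoose j := by
  induction r with
  | zero => simp [dff, dstirling_zero_zero]
  | succ r ih =>
    have hm (j : ℕ) : ((j : ℝ) + 1) * k.multichoose (j + 1) = (k + j) * k.multichoose j := by
      exact_mod_cast succ_mul_multichoose_succ k j
    set f : ℕ → ℝ := fun j =>
      (-1) ^ (r + 1 + j) * (j + r * lam) * (j.factorial * dstirling (-lam) r j) *
        k.multichoose j with hf
    have hlast : f (r + 1) = 0 := by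
      simp only [hf]
      rw [factorial_mul_dstirling_eq_zero_of_lt _ r.lt_succ_self]
      ring
    have hshift : ∑ j ∈ Finset.range (r + 1), f (j + 1) + f 0 =
        ∑ j ∈ Finset.range (r + 1), f j := by
      rw [← Finset.sum_range_succ', Finset.sum_range_succ, hlast, add_zero]
    have hstep : ∑ j ∈ Finset.range (r + 1), (-1 : ℝ) ^ (r + 1 + (j + 1)) *
          ((j + 1).factorial * dstirling (-lam) (r + 1) (j + 1)) * k.multichoose (j + 1) =
        ∑ j ∈ Finset.range (r + 1), (f (j + 1) + (-1) ^ (r + j) *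
          (j.factorial * dstirling (-lam) r j) * ((k + j) * k.multichoose j)) := by
      refine Finset.sum_congr rfl fun j _ => ?_
      rw [factorial_mul_dstirling_succ_succ, ← hm]
      simp only [hf]
      push_cast
      ring
    have hzero : (-1 : ℝ) ^ (r + 1 + 0) *
        ((Nat.factorial 0 : ℝ) * dstirling (-lam) (r + 1) 0) * k.multichoose 0 = f 0 := by
      rw [dstirling_succ_zero_eq_mul]
      simp only [hf]
      push_cast
      ring
    rw [dff_succ, ih, Finset.sum_range_succ' _ (r + 1), hstep, hzero, Finset.sum_add_distrib,
      add_right_comm, hshift, ← Finset.sum_add_distrib, Finset.sum_mul]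
    refine Finset.sum_congr rfl fun j _ => ?_
    simp only [hf]
    ring

theorem sum_dff_eq_neg_lam (lam : ℝ) (n : ℕ) (r : ℕ) (hr : 0 < r) :
    ∑ k ∈ Finset.range (n + 1), dff lam (k : ℝ) r =
      ∑ j ∈ Finset.range (r + 1),
        (-1 : ℝ) ^ (r - j) * (j.factorial : ℝ) * dstirling (-lam) r j * ((n + j).choose (j + 1) : ℝ) := by
  simp only [dff_eq_sum_multichoose]
  rw [Finset.sum_comm]
  refine Finset.sum_congr rfl fun j hj => ?_
  rw [← Finset.mul_sum]
  cases j with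
  | zero =>
    obtain ⟨r, rfl⟩ := Nat.exists_eq_succ_of_ne_zero hr.ne'
    simp [dstirling_succ_zero]
  | succ j =>
    have hjr : j + 1 ≤ r := Nat.lt_succ_iff.mp (Finset.mem_range.mp hj)
    have hsign : (-1 : ℝ) ^ (r + (j + 1)) = (-1) ^ (r - (j + 1)) := by
      rw [show r + (j + 1) = r - (j + 1) + 2 * (j + 1) by omega, pow_add, pow_mul]
      simp
    rw [← Nat.cast_sum, sum_range_multichoose_succ, hsign, mul_assoc _ ((j + 1).factorial : ℝ)]
end
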